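/- (ε-uniform space and time gradient bounds) Assume (A0) and (A1), and suppose the CFL condition (CFL′) is satisfied. If (U^{α,n}_i) is the numerical solution of the scheme (NS) with initial condition U^{α,0}_i = u₀^α(iΔx), then for every α = 1,…,N, every i ≥ 0 and every n ≥ 0: p̲⁰_α ≤ (U^{α,n}_{i+1} − U^{α,n}_i)/Δx ≤ p̄⁰_α and m⁰₀ ≤ (U^{α,n+1}_i − U^{α,n}_i)/Δt ≤ M⁰₀, where m⁰₀, M⁰₀, p̲⁰_α, p̄⁰_α depend only on the initial data and the Hamiltonians (not on Δx, Δt). -/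

import Mathlib

open Set Filter

/-- Assumption (A1) for a single Hamiltonian: `H` is `C¹`, coercive
(`H p → +∞` as `|p| → +∞`), non-increasing on `(-∞, p₀]` and non-decreasing on `[p₀, +∞)`. -/
def A1cond (H : ℝ → ℝ) (p₀ : ℝ) : Prop :=
  ContDiff ℝ 1 H ∧ Tendsto H (cocompact ℝ) atTop ∧
    AntitoneOn H (Iic p₀) ∧ MonotoneOn H (Ici p₀)

/-- The non-increasing envelope `H⁻` of `H` with turning point `p₀`. -/
noncomputable def Hm (H : ℝ → ℝ) (p₀ : ℝ) (p : ℝ) : ℝ :=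
  if p ≤ p₀ then H p else H p₀

/-- The non-decreasing envelope `H⁺` of `H` with turning point `p₀`. -/
noncomputable def Hp (H : ℝ → ℝ) (p₀ : ℝ) (p : ℝ) : ℝ :=
  if p ≤ p₀ then H p₀ else H p

/-- One time step of the numerical scheme (NS) on the junction:
`V` (the values at time `n+1`) is computed from `U` (the values at time `n`).
For `i ≥ 1` on each branch `α` the update uses
`max (H⁺_α(p_{i,-}), H⁻_α(p_{i,+}))`; at the junction point `i = 0` all branches share a
common value and the update uses `max_β H⁻_β(p^β_{0,+})`. -/
def SchemeStep {N : ℕ} (H : Fin N → ℝ → ℝ) (p₀ : Fin N → ℝ) (Δx Δt : ℝ)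
    (U V : Fin N → ℕ → ℝ) : Prop :=
  (∀ (α : Fin N) (i : ℕ), 1 ≤ i →
      V α i = U α i - Δt * max (Hp (H α) (p₀ α) ((U α i - U α (i - 1)) / Δx))
        (Hm (H α) (p₀ α) ((U α (i + 1) - U α i) / Δx))) ∧
  (∀ α β : Fin N, U α 0 = U β 0) ∧
  (∀ α : Fin N, V α 0 = U α 0 - Δt *
      sSup (Set.range fun β : Fin N => Hm (H β) (p₀ β) ((U β 1 - U β 0) / Δx)))

/-- The numerical scheme (NS): `U α n i` is the value on branch `α` at time step `n`
and grid point `i`. -/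
def SchemeNS {N : ℕ} (H : Fin N → ℝ → ℝ) (p₀ : Fin N → ℝ) (Δx Δt : ℝ)
    (U : Fin N → ℕ → ℕ → ℝ) : Prop :=
  ∀ n : ℕ, SchemeStep H p₀ Δx Δt (fun α i => U α n i) (fun α i => U α (n + 1) i)

section Envelopes

variable {H : ℝ → ℝ} {p₀ : ℝ}

theorem Hm_eq_min (H : ℝ → ℝ) (p₀ p : ℝ) : Hm H p₀ p = H (min p p₀) := by
  unfold Hm
  split_ifs with h
  · rw [min_eq_left h]
  · rw [min_eq_right (not_le.mp h).le]

theorem Hp_eq_max (H : ℝ → ℝ) (p₀ p : ℝ) : Hp H p₀ p = H (max p p₀) := by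
  unfold Hp
  split_ifs with h
  · rw [max_eq_right h]
  · rw [max_eq_left (not_le.mp h).le]

theorem Hp_eq_Hm_neg (H : ℝ → ℝ) (p₀ p : ℝ) :
    Hp H p₀ p = Hm (fun q => H (-q)) (-p₀) (-p) := by
  rw [Hp_eq_max, Hm_eq_min, min_neg_neg, neg_neg]

theorem A1cond.comp_neg (h : A1cond H p₀) : A1cond (fun q => H (-q)) (-p₀) := by
  obtain ⟨h1, h2, h3, h4⟩ := h
  refine ⟨h1.comp contDiff_neg, h2.comp (Homeomorph.neg ℝ).isClosedEmbedding.tendsto_cocompact,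
    ?_, ?_⟩
  · intro a ha b hb hab
    simp only [mem_Iic] at ha hb
    exact h4 (show p₀ ≤ -b by linarith) (show p₀ ≤ -a by linarith) (neg_le_neg hab)
  · intro a ha b hb hab
    simp only [mem_Ici] at ha hb
    exact h3 (show -b ≤ p₀ by linarith) (show -a ≤ p₀ by linarith) (neg_le_neg hab)

theorem A1cond.antitone_Hm (h : A1cond H p₀) : Antitone (Hm H p₀) := by
  intro a b hab
  simp only [Hm_eq_min]
  exact h.2.2.1 (mem_Iic.2 (min_le_right _ _)) (mem_Iic.2 (min_le_right _ _)) (min_le_min_right _ hab)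

theorem A1cond.monotone_Hp (h : A1cond H p₀) : Monotone (Hp H p₀) := by
  intro a b hab
  simp only [Hp_eq_max]
  exact h.2.2.2 (mem_Ici.2 (le_max_right _ _)) (mem_Ici.2 (le_max_right _ _)) (max_le_max_right _ hab)

theorem A1cond.apply_le (h : A1cond H p₀) (p : ℝ) : H p₀ ≤ H p := by
  rcases le_total p p₀ with hp | hp
  · exact h.2.2.1 hp (le_refl p₀) hp
  · exact h.2.2.2 (le_refl p₀) hp hp

theorem A1cond.Hm_le (h : A1cond H p₀) (p : ℝ) : Hm H p₀ p ≤ H p := by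
  unfold Hm
  split_ifs
  · exact le_rfl
  · exact h.apply_le p

theorem A1cond.Hp_le (h : A1cond H p₀) (p : ℝ) : Hp H p₀ p ≤ H p := by
  unfold Hp
  split_ifs
  · exact h.apply_le p
  · exact le_rfl

theorem A1cond.le_Hm (h : A1cond H p₀) (p : ℝ) : H p₀ ≤ Hm H p₀ p := by
  rw [Hm_eq_min]; exact h.apply_le _

theorem A1cond.sInf_level (h : A1cond H p₀) {c : ℝ} (hc : H p₀ ≤ c) :
    Hm H p₀ (sInf {p | Hm H p₀ p = c}) = c ∧ sInf {p | Hm H p₀ p = c} ≤ p₀ ∧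
      ∀ p, Hm H p₀ p ≤ c → sInf {p | Hm H p₀ p = c} ≤ p := by
  have hcont : Continuous (Hm H p₀) := by
    have : Hm H p₀ = fun p => H (min p p₀) := funext (Hm_eq_min H p₀)
    rw [this]
    exact h.1.continuous.comp (continuous_id.min continuous_const)
  have hbot : Tendsto H atBot atTop := h.2.1.mono_left atBot_le_cocompact
  obtain ⟨q, hq, hqp⟩ := ((hbot.eventually_gt_atTop c).and (eventually_le_atBot p₀)).exists
  have hmq : c < Hm H p₀ q := by rwa [Hm_eq_min, min_eq_left hqp]
  have hm0 : Hm H p₀ p₀ = H p₀ := by rw [Hm_eq_min, min_self]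
  obtain ⟨r, hr, hrc⟩ := intermediate_value_Icc' hqp hcont.continuousOn
    (show c ∈ Icc (Hm H p₀ p₀) (Hm H p₀ q) from ⟨hm0 ▸ hc, hmq.le⟩)
  have hbdd : BddBelow {p | Hm H p₀ p = c} := by
    refine ⟨q, fun p (hp : Hm H p₀ p = c) => ?_⟩
    by_contra! hlt
    exact absurd (h.antitone_Hm hlt.le) (by linarith)
  have hmem : Hm H p₀ (sInf {p | Hm H p₀ p = c}) = c :=
    (isClosed_eq hcont continuous_const).csInf_mem ⟨r, hrc⟩ hbdd
  refine ⟨hmem, (csInf_le hbdd hrc).trans hr.2, fun p hp => ?_⟩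
  by_contra! hlt
  have hpc : Hm H p₀ p = c := hp.antisymm (hmem ▸ h.antitone_Hm hlt.le)
  exact absurd (csInf_le hbdd hpc) (not_le.mpr hlt)

theorem A1cond.sSup_level (h : A1cond H p₀) {c : ℝ} (hc : H p₀ ≤ c) :
    Hp H p₀ (sSup {p | Hp H p₀ p = c}) = c ∧ p₀ ≤ sSup {p | Hp H p₀ p = c} ∧
      ∀ p, Hp H p₀ p ≤ c → p ≤ sSup {p | Hp H p₀ p = c} := by
  obtain ⟨h1, h2, h3⟩ := h.comp_neg.sInf_level (c := c) (by simpa using hc)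
  have hs : sInf {p | Hm (fun q => H (-q)) (-p₀) p = c} = -sSup {p | Hp H p₀ p = c} := by
    rw [Real.sInf_def]
    congr 2
    ext p
    simp [Hp_eq_Hm_neg]
  rw [hs] at h1 h2 h3
  refine ⟨by rw [Hp_eq_Hm_neg]; exact h1, by linarith, fun p hp => ?_⟩
  have := h3 (-p) (by rwa [← Hp_eq_Hm_neg])
  linarith

theorem A1cond.sub_le_of_deriv_le (h : A1cond H p₀) {a b K : ℝ}
    (hK : ∀ p ∈ Icc a b, |deriv H p| ≤ K) {x y : ℝ} (hx : x ∈ Icc a b) (hy : y ∈ Icc a b) :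
    H y - H x ≤ K * |y - x| := by
  have := (convex_Icc a b).norm_image_sub_le_of_norm_deriv_le (f := H) (C := K)
    (fun p _ => (h.1.differentiable one_ne_zero) p) hK hx hy
  exact (le_abs_self _).trans this

theorem A1cond.Hp_le_add (h : A1cond H p₀) {a b K : ℝ} (hK0 : 0 ≤ K)
    (hK : ∀ p ∈ Icc a b, |deriv H p| ≤ K) (hp₀ : p₀ ∈ Icc a b) {x y : ℝ}
    (hx : x ∈ Icc a b) (hy : y ∈ Icc a b) (hxy : x ≤ y) :
    Hp H p₀ y ≤ Hp H p₀ x + K * (y - x) := by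
  rw [Hp_eq_max, Hp_eq_max]
  have h1 := h.sub_le_of_deriv_le hK (x := max x p₀) (y := max y p₀)
    ⟨hx.1.trans (le_max_left _ _), max_le hx.2 hp₀.2⟩
    ⟨hy.1.trans (le_max_left _ _), max_le hy.2 hp₀.2⟩
  have h2 := mul_le_mul_of_nonneg_left (abs_max_sub_max_le_abs y x p₀) hK0
  rw [abs_of_nonneg (sub_nonneg.mpr hxy)] at h2
  linarith

theorem A1cond.Hm_le_add (h : A1cond H p₀) {a b K : ℝ} (hK0 : 0 ≤ K)
    (hK : ∀ p ∈ Icc a b, |deriv H p| ≤ K) (hp₀ : p₀ ∈ Icc a b) {x y : ℝ}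
    (hx : x ∈ Icc a b) (hy : y ∈ Icc a b) (hxy : x ≤ y) :
    Hm H p₀ x ≤ Hm H p₀ y + K * (y - x) := by
  rw [Hm_eq_min, Hm_eq_min]
  have h1 := h.sub_le_of_deriv_le hK (x := min y p₀) (y := min x p₀)
    ⟨le_min hy.1 hp₀.1, (min_le_left _ _).trans hy.2⟩
    ⟨le_min hx.1 hp₀.1, (min_le_left _ _).trans hx.2⟩
  have h2 := mul_le_mul_of_nonneg_left (abs_min_sub_min_le_max x p₀ y p₀) hK0
  rw [sub_self, abs_zero, max_eq_left (abs_nonneg _), abs_sub_comm x y,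
    abs_of_nonneg (sub_nonneg.mpr hxy)] at h2
  linarith

/-- If `Hp` attains the level `c` at the right endpoint `b` of the interval where the slope of
`H` is at most `K`, then a displacement whose linear increment stays below `c` keeps `Hp`
below `c`, wherever it ends. -/
theorem A1cond.Hp_le_of_add_le (h : A1cond H p₀) {a b K c : ℝ} (hK0 : 0 < K)
    (hK : ∀ p ∈ Icc a b, |deriv H p| ≤ K) (hp₀ : p₀ ∈ Icc a b) (hb : Hp H p₀ b = c)
    {p q : ℝ} (hp : p ∈ Icc a b) (hq : Hp H p₀ p + K * (q - p) ≤ c) : Hp H p₀ q ≤ c := by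
  rcases le_total q b with hqb | hbq
  · exact (h.monotone_Hp hqb).trans hb.le
  · have h1 := h.Hp_le_add hK0.le hK hp₀ hp ⟨hp.1.trans hp.2, le_rfl⟩ hp.2
    have h2 : K * (q - b) ≤ 0 := by linarith
    have h3 : q ≤ b := by
      by_contra! hlt
      exact absurd (mul_pos hK0 (sub_pos.mpr hlt)) (not_lt.mpr h2)
    exact (h.monotone_Hp h3).trans hb.le

/-- Counterpart of `A1cond.Hp_le_of_add_le` for `Hm` and the left endpoint. -/
theorem A1cond.Hm_le_of_add_le (h : A1cond H p₀) {a b K c : ℝ} (hK0 : 0 < K)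
    (hK : ∀ p ∈ Icc a b, |deriv H p| ≤ K) (hp₀ : p₀ ∈ Icc a b) (ha : Hm H p₀ a = c)
    {p q : ℝ} (hp : p ∈ Icc a b) (hq : Hm H p₀ p + K * (p - q) ≤ c) : Hm H p₀ q ≤ c := by
  have h3 : a ≤ q := by
    have h1 := h.Hm_le_add hK0.le hK hp₀ ⟨le_rfl, hp.1.trans hp.2⟩ hp hp.1
    by_contra! hlt
    have := mul_pos hK0 (sub_pos.mpr hlt)
    linarith
  exact (h.antitone_Hm h3).trans ha.le

end Envelopes

/-- **ε-uniform space and time gradient bounds** (Lemma 3.6).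
Assume (A0) (Lipschitz initial data with best Lipschitz constants `L^{α,-}`, `L^{α,+}`,
equal at the junction point) and (A1), and suppose the CFL condition (CFL′) holds.
If `U` is the numerical solution of (NS) with `U^{α,0}_i = u₀^α(iΔx)`, then for all
`α`, `i`, `n`: `p̲⁰_α ≤ p^{α,n}_{i,+} ≤ p̄⁰_α` and `m⁰₀ ≤ W^{α,n}_i ≤ M⁰₀`, where the
four constants, defined from the initial data and the Hamiltonians only, do not depend
on `Δx, Δt`. -/
theorem eps_uniform_gradient_bounds {N : ℕ} (hN : 1 ≤ N)
    (H : Fin N → ℝ → ℝ) (p₀ : Fin N → ℝ)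
    (hA1 : ∀ α, A1cond (H α) (p₀ α))
    (u₀ : Fin N → ℝ → ℝ)
    (hcompat : ∀ α β : Fin N, u₀ α 0 = u₀ β 0)
    (Lm Lp : Fin N → ℝ)
    (hLp : ∀ α, IsLeast
      {L : ℝ | ∀ x a : ℝ, 0 ≤ x → 0 ≤ a → u₀ α (x + a) - u₀ α x ≤ a * L} (Lp α))
    (hLm : ∀ α, IsGreatest
      {L : ℝ | ∀ x a : ℝ, 0 ≤ x → 0 ≤ a → a * L ≤ u₀ α (x + a) - u₀ α x} (Lm α))
    (Δx Δt : ℝ) (hΔx : 0 < Δx) (hΔt : 0 < Δt)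
    (U : Fin N → ℕ → ℕ → ℝ)
    (hU : SchemeNS H p₀ Δx Δt U)
    (hinit : ∀ (α : Fin N) (i : ℕ), U α 0 i = u₀ α (i * Δx))
    (m0 : ℝ)
    (hm0 : m0 = sInf (Set.range fun q : Fin N × ℕ => (U q.1 1 q.2 - U q.1 0 q.2) / Δt))
    (plow pbar : Fin N → ℝ)
    (hplow : ∀ α, plow α = sInf {p : ℝ | Hm (H α) (p₀ α) p = -m0})
    (hpbar : ∀ α, pbar α = sSup {p : ℝ | Hp (H α) (p₀ α) p = -m0})
    (hCFL : ∀ α : Fin N, ∀ p ∈ Icc (plow α) (pbar α), |deriv (H α) p| ≤ Δx / Δt)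
    (m00 M00 : ℝ)
    (hm00 : m00 = sInf {v : ℝ | ∃ (α : Fin N) (p : ℝ),
      Lm α ≤ p ∧ p ≤ Lp α ∧ v = -(H α p)})
    (hM00 : M00 = max
      (sSup (Set.range fun α : Fin N =>
        min (-(Hp (H α) (p₀ α) (Lm α))) (-(Hm (H α) (p₀ α) (Lp α)))))
      (sInf (Set.range fun α : Fin N => -(Hm (H α) (p₀ α) (Lp α)))))
    (plow0 pbar0 : Fin N → ℝ)
    (hplow0 : ∀ α, plow0 α = sInf {p : ℝ | Hm (H α) (p₀ α) p = -m00})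
    (hpbar0 : ∀ α, pbar0 α = sSup {p : ℝ | Hp (H α) (p₀ α) p = -m00}) :
    ∀ (α : Fin N) (n i : ℕ),
      (plow0 α ≤ (U α n (i + 1) - U α n i) / Δx ∧
        (U α n (i + 1) - U α n i) / Δx ≤ pbar0 α) ∧
      (m00 ≤ (U α (n + 1) i - U α n i) / Δt ∧
        (U α (n + 1) i - U α n i) / Δt ≤ M00) := by
  have : Nonempty (Fin N) := ⟨⟨0, hN⟩⟩
  set w : ℕ → Fin N → ℕ → ℝ := fun n α i => (U α (n + 1) i - U α n i) / Δt with hw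
  set p : ℕ → Fin N → ℕ → ℝ := fun n α i => (U α n (i + 1) - U α n i) / Δx with hp
  set K := Δx / Δt with hKdef
  have hK0 : 0 < K := div_pos hΔx hΔt
  have hstep : ∀ n α i, K * (p (n + 1) α i - p n α i) = w n α (i + 1) - w n α i := by
    intro n α i
    simp only [hw, hp, hKdef]
    field_simp
    ring
  have hw_succ : ∀ n α i, -w n α (i + 1) =
      max (Hp (H α) (p₀ α) (p n α i)) (Hm (H α) (p₀ α) (p n α (i + 1))) := by
    intro n α i
    have h := (hU n).1 α (i + 1) (by omega)
    simp only [Nat.add_sub_cancel] at h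
    simp only [hw, hp, h]
    field_simp
    ring
  have hw_zero : ∀ n α, -w n α 0 =
      sSup (range fun β : Fin N => Hm (H β) (p₀ β) (p n β 0)) := by
    intro n α
    have h := (hU n).2.2 α
    simp only at h
    simp only [hw, hp, h, zero_add]
    field_simp
    ring
  have hw_Hp : ∀ n α i, Hp (H α) (p₀ α) (p n α i) ≤ -w n α (i + 1) := fun n α i => by
    rw [hw_succ]; exact le_max_left _ _
  have hw_Hm : ∀ n α i, Hm (H α) (p₀ α) (p n α i) ≤ -w n α i := by
    rintro n α (_ | i)
    · rw [hw_zero]; exact le_csSup (finite_range _).bddAbove ⟨α, rfl⟩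
    · rw [hw_succ]; exact le_max_right _ _
  have hw_attained : ∀ n α i, (∃ j, i = j + 1 ∧ -w n α i = Hp (H α) (p₀ α) (p n α j)) ∨
      ∃ β, (∀ k, w k β i = w k α i) ∧ -w n α i = Hm (H β) (p₀ β) (p n β i) := by
    rintro n α (_ | i)
    · obtain ⟨β, hβ⟩ := (range_nonempty fun β : Fin N => Hm (H β) (p₀ β) (p n β 0)).csSup_mem
        (finite_range _)
      exact .inr ⟨β, fun k => neg_injective ((hw_zero k β).trans (hw_zero k α).symm),
        (hw_zero n α).trans hβ.symm⟩
    · rw [hw_succ]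
      rcases max_choice (Hp (H α) (p₀ α) (p n α i)) (Hm (H α) (p₀ α) (p n α (i + 1))) with h | h
      · exact .inl ⟨i, rfl, h⟩
      · exact .inr ⟨α, fun _ => rfl, h⟩
  have hp_init : ∀ α i, p 0 α i ∈ Icc (Lm α) (Lp α) := by
    intro α i
    have h1 := (hLm α).1 (i * Δx) Δx (by positivity) hΔx.le
    have h2 := (hLp α).1 (i * Δx) Δx (by positivity) hΔx.le
    have h3 : ((i + 1 : ℕ) : ℝ) * Δx = i * Δx + Δx := by push_cast; ring
    simp only [hp, hinit, h3]
    exact ⟨(le_div_iff₀' hΔx).2 h1, (div_le_iff₀' hΔx).2 h2⟩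
  have hm00_le : ∀ α, ∀ q ∈ Icc (Lm α) (Lp α), H α q ≤ -m00 := by
    intro α q hq
    have hbdd : BddBelow {v : ℝ | ∃ (α : Fin N) (p : ℝ),
        Lm α ≤ p ∧ p ≤ Lp α ∧ v = -(H α p)} := by
      have hcomp : IsCompact (⋃ α, (fun p => -(H α p)) '' Icc (Lm α) (Lp α)) :=
        isCompact_iUnion fun α => isCompact_Icc.image (hA1 α).1.continuous.neg
      refine hcomp.bddBelow.mono ?_
      rintro v ⟨α, p, h1, h2, rfl⟩
      exact mem_iUnion.2 ⟨α, p, ⟨h1, h2⟩, rfl⟩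
    have := csInf_le hbdd ⟨α, q, hq.1, hq.2, rfl⟩
    rw [← hm00] at this
    linarith
  have hw_init : ∀ α i, m00 ≤ w 0 α i := by
    intro α i
    rcases hw_attained 0 α i with ⟨j, -, h⟩ | ⟨β, -, h⟩
    · linarith [(hA1 α).Hp_le (p 0 α j), hm00_le α _ (hp_init α j)]
    · linarith [(hA1 β).Hm_le (p 0 β i), hm00_le β _ (hp_init β i)]
  have hm0_le : ∀ α i, m0 ≤ w 0 α i := by
    intro α i
    rw [hm0]
    refine csInf_le ⟨m00, ?_⟩ ⟨(α, i), rfl⟩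
    rintro _ ⟨⟨β, j⟩, rfl⟩
    exact hw_init β j
  have hm00_m0 : m00 ≤ m0 := by
    rw [hm0]
    refine le_csInf (range_nonempty _) ?_
    rintro _ ⟨⟨β, j⟩, rfl⟩
    exact hw_init β j
  have hH_m0 : ∀ α, H α (p₀ α) ≤ -m0 := fun α => by
    linarith [(hA1 α).le_Hm (p 0 α 0), hw_Hm 0 α 0, hm0_le α 0]
  have hlow := fun α => hplow α ▸ (hA1 α).sInf_level (hH_m0 α)
  have hbar := fun α => hpbar α ▸ (hA1 α).sSup_level (hH_m0 α)
  have hp₀ : ∀ α, p₀ α ∈ Icc (plow α) (pbar α) := fun α => ⟨(hlow α).2.1, (hbar α).2.1⟩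
  have hp_mem : ∀ n, (∀ α i, m0 ≤ w n α i) → ∀ α i, p n α i ∈ Icc (plow α) (pbar α) := by
    intro n hn α i
    exact ⟨(hlow α).2.2 _ (by linarith [hw_Hm n α i, hn α i]),
      (hbar α).2.2 _ (by linarith [hw_Hp n α i, hn α (i + 1)])⟩
  have hw_lower : ∀ n α i, m0 ≤ w n α i := by
    intro n
    induction n with
    | zero => exact hm0_le
    | succ n ih =>
      intro α i
      rcases hw_attained (n + 1) α i with ⟨j, -, h⟩ | ⟨β, -, h⟩
      · have := (hA1 α).Hp_le_of_add_le hK0 (hCFL α) (hp₀ α) (hbar α).1 (q := p (n + 1) α j)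
          (hp_mem n ih α j) (by linarith [hstep n α j, hw_Hp n α j, ih α j])
        linarith
      · have := (hA1 β).Hm_le_of_add_le hK0 (hCFL β) (hp₀ β) (hlow β).1 (q := p (n + 1) β i)
          (hp_mem n ih β i) (by linarith [hstep n β i, hw_Hm n β i, ih β (i + 1)])
        linarith
  have hp_bounds := fun n => hp_mem n (hw_lower n)
  have hw_upper : ∀ n α i, w n α i ≤ M00 := by
    intro n
    induction n with
    | zero =>
      rw [hM00]
      rintro α (_ | i)
      · refine le_max_of_le_right (le_csInf (range_nonempty _) ?_)
        rintro _ ⟨β, rfl⟩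
        have h1 := (hA1 β).antitone_Hm (hp_init β 0).2
        have h2 := hw_Hm 0 β 0
        have h3 := (hw_zero 0 β).trans (hw_zero 0 α).symm
        simp only
        linarith
      · refine le_max_of_le_left (le_trans (le_min ?_ ?_)
          (le_csSup (finite_range _).bddAbove ⟨α, rfl⟩))
        · linarith [(hA1 α).monotone_Hp (hp_init α i).1, hw_Hp 0 α i]
        · linarith [(hA1 α).antitone_Hm (hp_init α (i + 1)).2, hw_Hm 0 α (i + 1)]
    | succ n ih =>
      intro α i
      rcases hw_attained n α i with ⟨j, rfl, h⟩ | ⟨β, hβ, h⟩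
      · have h1 := hw_Hp (n + 1) α j
        rcases le_total (p n α j) (p (n + 1) α j) with hle | hle
        · linarith [(hA1 α).monotone_Hp hle, ih α (j + 1)]
        · linarith [(hA1 α).Hp_le_add hK0.le (hCFL α) (hp₀ α) (hp_bounds (n + 1) α j)
            (hp_bounds n α j) hle, hstep n α j, ih α j]
      · have h1 := hw_Hm (n + 1) β i
        rw [← hβ (n + 1)]
        have h2 := hβ n
        rcases le_total (p n β i) (p (n + 1) β i) with hle | hle
        · linarith [(hA1 β).Hm_le_add hK0.le (hCFL β) (hp₀ β) (hp_bounds n β i)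
            (hp_bounds (n + 1) β i) hle, hstep n β i, ih β (i + 1)]
        · linarith [(hA1 β).antitone_Hm hle, ih α i]
  intro α n i
  have hH_m00 : H α (p₀ α) ≤ -m00 := by linarith [hH_m0 α]
  refine ⟨⟨?_, ?_⟩, hm00_m0.trans (hw_lower n α i), hw_upper n α i⟩
  · rw [hplow0]
    exact ((hA1 α).sInf_level hH_m00).2.2 _ (by linarith [hw_Hm n α i, hw_lower n α i])
  · rw [hpbar0]
    exact ((hA1 α).sSup_level hH_m00).2.2 _ (by linarith [hw_Hp n α i, hw_lower n α (i + 1)])
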